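/- For every integer k ≥ 1 there exists a nested almost convex set X ⊆ ℝ² with |X| = 2^(k+1) − 2 such that every point of X has integer coordinates of absolute value at most 2·5^(k+1). -/

import Mathlib

open Set

noncomputable section

/-- Points of the plane. -/
abbrev Pt : Type := ℝ × ℝ

/-- The orientation determinant of the triple `(a, b, c)`:
`c` lies strictly to the left of the directed line from `a` to `b` iff `orient a b c > 0`. -/
def orient (a b c : Pt) : ℝ :=
  (b.1 - a.1) * (c.2 - a.2) - (b.2 - a.2) * (c.1 - a.1)

/-- A set of points is in general position if no three pairwise distinct points are collinear. -/
def GenPos (X : Set Pt) : Prop :=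
  ∀ a ∈ X, ∀ b ∈ X, ∀ c ∈ X, a ≠ b → a ≠ c → b ≠ c → orient a b c ≠ 0

/-- The set of extreme points of the convex hull of `S`. -/
def extremePts (S : Set Pt) : Set Pt := Set.extremePoints ℝ (convexHull ℝ S)

/-- Remove the extreme points of the convex hull (one peeling step of convex layers). -/
def peel (S : Set Pt) : Set Pt := S \ extremePts S

/-- `X` has exactly `k` convex layers. -/
def HasLayers (X : Set Pt) (k : ℕ) : Prop :=
  peel^[k] X = ∅ ∧ ∀ j < k, peel^[j] X ≠ ∅

/-- `X_j`, the union of the `j` innermost convex layers (when `X` has `k` layers). -/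
def layerSub (X : Set Pt) (k j : ℕ) : Set Pt := peel^[k - j] X

/-- `R_j`, the `j`-th convex layer of `X` (when `X` has `k` layers), `R_1` innermost. -/
def layer (X : Set Pt) (k j : ℕ) : Set Pt := extremePts (layerSub X k j)

/-- `X` is a nested almost convex set. -/
def IsNACS (X : Set Pt) : Prop :=
  X.Finite ∧ X.Nonempty ∧ GenPos X ∧
  ∀ k, HasLayers X k →
    ∀ j, 1 ≤ j → j ≤ k →
      ∀ a ∈ layer X k j, ∀ b ∈ layer X k j, ∀ c ∈ layer X k j,
        a ≠ b → a ≠ c → b ≠ c →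
        ∃! p : Pt, p ∈ layerSub X k (j - 1) ∩ interior (convexHull ℝ ({a, b, c} : Set Pt))

/-- `q` is a counterclockwise enumeration of `S`. -/
def CCWEnum {m : ℕ} (S : Set Pt) (q : Fin m → Pt) : Prop :=
  Function.Injective q ∧ Set.range q = S ∧
  ∀ a b c : Fin m, a < b → b < c → 0 < orient (q a) (q b) (q c)

/-- The ordered pair `(q1, q2)` of points of `R` is adoptable from `p`. -/
def AdoptablePair (R : Set Pt) (p q1 q2 : Pt) : Prop :=
  ∀ q3 ∈ R \ ({q1, q2} : Set Pt), p ∈ interior (convexHull ℝ ({q1, q2, q3} : Set Pt))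

/-- The `i`-th binary string of length `j` in lexicographic order (`false` before `true`). -/
def strOfNat (j i : ℕ) : List Bool :=
  (List.range j).map fun t => i.testBit (j - 1 - t)

/-- The numeric (lexicographic) rank of a binary string among strings of its length. -/
def natOfStr (s : List Bool) : ℕ := s.foldl (fun n b => 2 * n + b.toNat) 0

/-- The leftmost `k`-level descendant of the node `s`. -/
def firstStr (k : ℕ) (s : List Bool) : List Bool := s ++ List.replicate (k - s.length) false

/-- The rightmost `k`-level descendant of the node `s`. -/
def lastStr (k : ℕ) (s : List Bool) : List Bool := s ++ List.replicate (k - s.length) true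

/-- Non-root nodes of the tree `T₁(k)`: binary strings of length `1..k`. -/
def ValidNode1 (k : ℕ) (s : List Bool) : Prop := 1 ≤ s.length ∧ s.length ≤ k

/-- A type-1 labeling of `X`, given by its label function `x` (the inverse of `ψ`). -/
def IsLabeling1 (k : ℕ) (X : Set Pt) (x : List Bool → Pt) : Prop :=
  Set.InjOn x {s | ValidNode1 k s} ∧ x '' {s | ValidNode1 k s} = X

/-- A type-1 labeling is nested. -/
def Nested1 (k : ℕ) (X : Set Pt) (x : List Bool → Pt) : Prop :=
  ∀ j, 1 ≤ j → j ≤ k →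
    CCWEnum (layer X k j) fun i : Fin (2 ^ j) => x (strOfNat j i.val)

/-- A type-1 labeling is adoptable. -/
def Adoptable1 (k : ℕ) (X : Set Pt) (x : List Bool → Pt) : Prop :=
  ∀ s : List Bool, 1 ≤ s.length → s.length + 1 ≤ k →
    AdoptablePair (layer X k (s.length + 1)) (x s) (x (s ++ [false])) (x (s ++ [true]))

/-- `previous[R_k(u)]` for a type-1 labeling: the cyclic predecessor (in the left-to-right,
i.e. counterclockwise, order of the `k`-level) of `first[R_k(u)]`. -/
def prev1 (k : ℕ) (x : List Bool → Pt) (s : List Bool) : Pt :=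
  x (strOfNat k ((natOfStr (firstStr k s) + (2 ^ k - 1)) % 2 ^ k))

/-- `next[R_k(u)]` for a type-1 labeling: the cyclic successor of `last[R_k(u)]`. -/
def next1 (k : ℕ) (x : List Bool → Pt) (s : List Bool) : Pt :=
  x (strOfNat k ((natOfStr (lastStr k s) + 1) % 2 ^ k))

/-- A type-1 labeling is well laid. -/
def WellLaid1 (k : ℕ) (x : List Bool → Pt) : Prop :=
  ∀ s : List Bool, 1 ≤ s.length → s.length ≤ k →
    x s ∈ convexHull ℝ ({prev1 k x s, x (firstStr k s), x (lastStr k s)} : Set Pt) ∧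
    x s ∈ convexHull ℝ ({x (firstStr k s), x (lastStr k s), next1 k x s} : Set Pt)

/-- `X_u` for a type-1 labeling: the labels of the proper descendants of `s`. -/
def descSet1 (k : ℕ) (x : List Bool → Pt) (s : List Bool) : Set Pt :=
  x '' {t | ValidNode1 k t ∧ s <+: t ∧ s ≠ t}

/-- `X̄_u = X_u ∪ {x_u}` for a type-1 labeling. -/
def barSet1 (k : ℕ) (x : List Bool → Pt) (s : List Bool) : Set Pt :=
  insert (x s) (descSet1 k x s)

/-- A type-1 labeling is an internal separation. -/
def InternalSep1 (k : ℕ) (X : Set Pt) (x : List Bool → Pt) : Prop :=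
  ∀ s : List Bool, s.length + 1 ≤ k →
    ∀ y ∈ X \ descSet1 k x s,
      ∀ a ∈ barSet1 k x (s ++ [false]), ∀ b ∈ barSet1 k x (s ++ [true]),
        0 < orient a b y

/-- A type-1 labeling is an external separation. -/
def ExternalSep1 (k : ℕ) (X : Set Pt) (x : List Bool → Pt) : Prop :=
  ∀ s : List Bool, 1 ≤ s.length → s.length + 1 ≤ k →
    ∀ y ∈ X \ barSet1 k x s,
      (∀ a ∈ barSet1 k x (s ++ [false]), 0 < orient a (x s) y) ∧
      (∀ b ∈ barSet1 k x (s ++ [true]), 0 < orient (x s) b y)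

/-- Nodes of the tree `T₂(k)`: the root `none`, and pairs `(c, s)`. -/
abbrev Node2 : Type := Option (Fin 3 × List Bool)

/-- Valid nodes of `T₂(k)`: the root, and pairs `(c, s)` with `|s| ≤ k - 2`. -/
def ValidNode2 (k : ℕ) : Node2 → Prop
  | none => True
  | some (_, s) => s.length + 2 ≤ k

/-- A type-2 labeling of `X`, given by its label function `x` (the inverse of `ψ`). -/
def IsLabeling2 (k : ℕ) (X : Set Pt) (x : Node2 → Pt) : Prop :=
  Set.InjOn x {u | ValidNode2 k u} ∧ x '' {u | ValidNode2 k u} = X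

/-- The `i`-th node (left-to-right) of the `(j+2)`-level of `T₂(k)`. -/
def node2At (j i : ℕ) : Node2 :=
  some (⟨i / 2 ^ j % 3, by omega⟩, strOfNat j (i % 2 ^ j))

/-- A type-2 labeling is nested. -/
def Nested2 (k : ℕ) (X : Set Pt) (x : Node2 → Pt) : Prop :=
  CCWEnum (layer X k 1) (fun _ : Fin 1 => x none) ∧
  ∀ j : ℕ, j + 2 ≤ k →
    CCWEnum (layer X k (j + 2)) fun i : Fin (3 * 2 ^ j) => x (node2At j i.val)

/-- A type-2 labeling is adoptable. -/
def Adoptable2 (k : ℕ) (X : Set Pt) (x : Node2 → Pt) : Prop :=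
  ∀ (c : Fin 3) (s : List Bool), s.length + 3 ≤ k →
    AdoptablePair (layer X k (s.length + 3)) (x (some (c, s)))
      (x (some (c, s ++ [false]))) (x (some (c, s ++ [true])))

/-- `previous[R_k(u)]` for a type-2 labeling, `u = (c, s)`. -/
def prev2 (k : ℕ) (x : Node2 → Pt) (c : Fin 3) (s : List Bool) : Pt :=
  x (node2At (k - 2)
      ((c.val * 2 ^ (k - 2) + natOfStr (firstStr (k - 2) s) + (3 * 2 ^ (k - 2) - 1)) %
        (3 * 2 ^ (k - 2))))

/-- `next[R_k(u)]` for a type-2 labeling, `u = (c, s)`. -/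
def next2 (k : ℕ) (x : Node2 → Pt) (c : Fin 3) (s : List Bool) : Pt :=
  x (node2At (k - 2)
      ((c.val * 2 ^ (k - 2) + natOfStr (lastStr (k - 2) s) + 1) % (3 * 2 ^ (k - 2))))

/-- A type-2 labeling is well laid (the root is the only node with `R_k(u) = R_k`). -/
def WellLaid2 (k : ℕ) (x : Node2 → Pt) : Prop :=
  ∀ (c : Fin 3) (s : List Bool), s.length + 2 ≤ k →
    x (some (c, s)) ∈ convexHull ℝ
      ({prev2 k x c s, x (some (c, firstStr (k - 2) s)),
        x (some (c, lastStr (k - 2) s))} : Set Pt) ∧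
    x (some (c, s)) ∈ convexHull ℝ
      ({x (some (c, firstStr (k - 2) s)), x (some (c, lastStr (k - 2) s)),
        next2 k x c s} : Set Pt)

/-- `X_u` for a type-2 labeling and a non-root node `u = (c, s)`. -/
def descSet2 (k : ℕ) (x : Node2 → Pt) (c : Fin 3) (s : List Bool) : Set Pt :=
  x '' {u | ∃ t : List Bool, u = some (c, t) ∧ t.length + 2 ≤ k ∧ s <+: t ∧ s ≠ t}

/-- `X̄_u = X_u ∪ {x_u}` for a type-2 labeling and a non-root node `u = (c, s)`. -/
def barSet2 (k : ℕ) (x : Node2 → Pt) (c : Fin 3) (s : List Bool) : Set Pt :=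
  insert (x (some (c, s))) (descSet2 k x c s)

/-- A type-2 labeling is an internal separation. -/
def InternalSep2 (k : ℕ) (X : Set Pt) (x : Node2 → Pt) : Prop :=
  (∀ (c : Fin 3) (s : List Bool), s.length + 3 ≤ k →
    ∀ y ∈ X \ descSet2 k x c s,
      ∀ a ∈ barSet2 k x c (s ++ [false]), ∀ b ∈ barSet2 k x c (s ++ [true]),
        0 < orient a b y) ∧
  (∀ i : Fin 3,
    ∀ y ∈ X \ (barSet2 k x i [] ∪ barSet2 k x (i + 1) []),
      ∀ a ∈ barSet2 k x i [], ∀ b ∈ barSet2 k x (i + 1) [],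
        0 < orient a b y)

/-- A type-2 labeling is an external separation. -/
def ExternalSep2 (k : ℕ) (X : Set Pt) (x : Node2 → Pt) : Prop :=
  ∀ (c : Fin 3) (s : List Bool), s.length + 3 ≤ k →
    ∀ y ∈ X \ barSet2 k x c s,
      (∀ a ∈ barSet2 k x c (s ++ [false]), 0 < orient a (x (some (c, s))) y) ∧
      (∀ b ∈ barSet2 k x c (s ++ [true]), 0 < orient (x (some (c, s))) b y)

/-- One corner-refinement step: from `α_s = (q, o, p)` to `α_{s0}` (for `b = false`)
or `α_{s1}` (for `b = true`). -/
def cornerStep (α : Pt × Pt × Pt) (b : Bool) : Pt × Pt × Pt :=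
  let q := α.1
  let o := α.2.1
  let p := α.2.2
  if b then (o + (1 / 5 : ℝ) • (q - o), o + (1 / 5 : ℝ) • (p - o), o + (2 / 5 : ℝ) • (p - o))
  else (o + (2 / 5 : ℝ) • (q - o), o + (1 / 5 : ℝ) • (q - o), o + (1 / 5 : ℝ) • (p - o))

/-- The corner `α_s = (q_s, o_s, p_s)` assigned to the binary string `s` (with parameter `k`). -/
def corner (k : ℕ) (s : List Bool) : Pt × Pt × Pt :=
  s.foldl cornerStep
    (((0 : ℝ), (2 * 5 ^ (k + 1) : ℝ)), ((0 : ℝ), (0 : ℝ)), ((2 * 5 ^ (k + 1) : ℝ), (0 : ℝ)))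

/-- The point `y_v` for a binary string `v = s ++ [b]` of positive length. -/
def ypt (k : ℕ) (v : List Bool) : Pt :=
  let α := corner k v.dropLast
  if v.getLastD false then α.2.1 + (1 / 5 : ℝ) • (α.2.2 - α.2.1)
  else α.2.1 + (1 / 5 : ℝ) • (α.1 - α.2.1)

/-- The point `x_s`: the midpoint of `y_{s·0^(k+1−|s|)}` and `y_{s·1^(k+1−|s|)}`. -/
def xpt (k : ℕ) (s : List Bool) : Pt :=
  (1 / 2 : ℝ) •
    (ypt k (s ++ List.replicate (k + 1 - s.length) false) +
      ypt k (s ++ List.replicate (k + 1 - s.length) true))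

/-! ### The points in normalized coordinates -/

def cc (h : ℕ) : ℝ := (1 - (1 / 5) ^ h) / 4

lemma cc_succ (h : ℕ) : cc (h + 1) = (1 + cc h) / 5 := by
  unfold cc; rw [pow_succ]; ring

lemma cc_zero : cc 0 = 0 := by simp [cc]

lemma cc_lt (h : ℕ) : cc h < 1 / 4 := by
  have : (0 : ℝ) < (1 / 5) ^ h := by positivity
  unfold cc; linarith

lemma cc_nonneg (h : ℕ) : 0 ≤ cc h := by
  induction h with
  | zero => rw [cc_zero]
  | succ n ih => rw [cc_succ]; linarith

lemma cc_ge (h : ℕ) (hh : 1 ≤ h) : 1 / 5 ≤ cc h := by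
  obtain ⟨n, rfl⟩ : ∃ n, h = n + 1 := ⟨h - 1, by omega⟩
  rw [cc_succ]; linarith [cc_nonneg n]

lemma cc_ge' (h : ℕ) (hh : 2 ≤ h) : 6 / 25 ≤ cc h := by
  obtain ⟨n, rfl⟩ : ∃ n, h = n + 1 := ⟨h - 1, by omega⟩
  rw [cc_succ]; linarith [cc_ge n (by omega)]

def TT (b : Bool) (p : Pt) : Pt :=
  if b then ((1 - p.2 + p.1) / 5, p.2 / 5) else (p.1 / 5, (1 - p.1 + p.2) / 5)

def UU (b : Bool) (p : Pt) : Pt :=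
  if b then (5 * (p.1 + p.2) - 1, 5 * p.2) else (5 * p.1, 5 * (p.1 + p.2) - 1)

def PP : ℕ → List Bool → Pt
  | h, [] => (cc h / 2, cc h / 2)
  | h, b :: s => TT b (PP (h - 1) s)

def DD (h : ℕ) (p : Pt) : Prop := 0 < p.1 ∧ 0 < p.2 ∧ p.1 + p.2 ≤ cc h

def EE (p : Pt) : Prop := 0 ≤ p.1 ∧ 0 ≤ p.2 ∧ 1 / 2 ≤ p.1 + p.2

lemma TT_UU (b : Bool) (p : Pt) : TT b (UU b p) = p := by
  cases b <;> ext <;> simp [TT, UU] <;> ring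

lemma UU_TT (b : Bool) (p : Pt) : UU b (TT b p) = p := by
  cases b <;> ext <;> simp [TT, UU] <;> ring

lemma orient_TT (b : Bool) (p q r : Pt) :
    orient (TT b p) (TT b q) (TT b r) = orient p q r / 25 := by
  cases b <;> simp [TT, orient] <;> ring

lemma orient_UU (b : Bool) (p q r : Pt) :
    orient (TT b p) (TT b q) r = orient p q (UU b r) / 25 := by
  rw [← orient_TT b, TT_UU]

lemma orient_cyc (a b c : Pt) : orient a b c = orient b c a := by
  unfold orient; ring

lemma orient_swap (a b c : Pt) : orient a b c = -orient b a c := by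
  unfold orient; ring

lemma orient_flip (a b c : Pt) : orient a b c = -orient c b a := by
  unfold orient; ring

lemma orient_last (a b c : Pt) : orient a b c = -orient a c b := by
  unfold orient; ring

lemma PP_DD : ∀ (s : List Bool) (h : ℕ), s.length < h → DD h (PP h s)
  | [], h, hh => by
      have := cc_ge h (by simp at hh; omega)
      simp only [PP, DD]
      refine ⟨?_, ?_, ?_⟩ <;> linarith
  | b :: s, h, hh => by
      obtain ⟨n, rfl⟩ : ∃ n, h = n + 1 := ⟨h - 1, by simp at hh; omega⟩
      obtain ⟨h1, h2, h3⟩ := PP_DD s n (by simpa using hh)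
      have := cc_lt n
      have := cc_succ n
      cases b <;> simp only [PP, DD, TT, Nat.add_sub_cancel] <;>
        refine ⟨?_, ?_, ?_⟩ <;> simp <;> linarith

lemma EE_UU (b : Bool) (e : Pt) (he : EE e) : EE (UU b e) := by
  obtain ⟨h1, h2, h3⟩ := he
  cases b <;> refine ⟨?_, ?_, ?_⟩ <;> simp [UU] <;> linarith

/-- A node outside of the `b`-subtree is far away in the frame of this subtree. -/
lemma EE_slot (b : Bool) (s : List Bool) (h : ℕ) (hh : s.length < h)
    (hs : ∀ t, s ≠ b :: t) : EE (UU b (PP h s)) := by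
  cases s with
  | nil =>
    have := cc_ge h (by simp at hh; omega)
    cases b <;> refine ⟨?_, ?_, ?_⟩ <;> simp [UU, PP] <;> linarith
  | cons b' t =>
    have hb : b' = !b := by
      by_contra hne
      exact hs t (by cases b <;> cases b' <;> simp_all)
    subst hb
    obtain ⟨h1, h2, h3⟩ := PP_DD t (h - 1) (by simp at hh; omega)
    have := cc_lt (h - 1)
    cases b <;> refine ⟨?_, ?_, ?_⟩ <;> simp [UU, PP, TT] <;> linarith

lemma orient_EE {p q e : Pt} (he : EE e) (h1 : q.2 ≤ p.2) (h2 : p.1 ≤ q.1)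
    (h3 : 0 < orient p q (1 / 2, 0)) (h4 : 0 < orient p q (0, 1 / 2)) : 0 < orient p q e := by
  obtain ⟨e1, e2, e3⟩ := he
  unfold orient at *
  simp only at h3 h4
  by_cases hc : p.2 - q.2 ≤ q.1 - p.1
  · nlinarith [mul_nonneg (sub_nonneg.2 hc) e2, mul_nonneg (sub_nonneg.2 h1) (sub_nonneg.2 e3)]
  · push Not at hc
    nlinarith [mul_nonneg (sub_nonneg.2 hc.le) e1, mul_nonneg (sub_nonneg.2 h2) (sub_nonneg.2 e3)]

lemma internal_EE {h : ℕ} {p q e : Pt} (hp : DD h p) (hq : DD h q) (he : EE e) :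
    0 < orient (TT false p) (TT true q) e := by
  obtain ⟨p1, p2, p3⟩ := hp
  obtain ⟨q1, q2, q3⟩ := hq
  have hc := cc_lt h
  apply orient_EE he
  · simp [TT]; linarith
  · simp [TT]; linarith
  · simp [TT, orient]; nlinarith
  · simp [TT, orient]; nlinarith

lemma internal_center {h : ℕ} {p q : Pt} (hp : DD h p) (hq : DD h q) :
    0 < orient (TT false p) (TT true q) (cc (h + 1) / 2, cc (h + 1) / 2) := by
  obtain ⟨p1, p2, p3⟩ := hp
  obtain ⟨q1, q2, q3⟩ := hq
  have hc := cc_lt h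
  rw [cc_succ]
  simp [TT, orient]
  nlinarith

lemma external_false {h : ℕ} {p e : Pt} (hp : DD h p) (h1 : 1 ≤ h) (he : EE e) :
    0 < orient (TT false p) (cc (h + 1) / 2, cc (h + 1) / 2) e := by
  obtain ⟨p1, p2, p3⟩ := hp
  have hc := cc_lt h
  have hc1 := cc_lt (h + 1)
  have hc2 := cc_ge' (h + 1) (by omega)
  generalize cc (h + 1) = m at *
  apply orient_EE he
  · simp [TT]; linarith
  · simp [TT]; linarith
  · simp [TT, orient]; nlinarith
  · simp [TT, orient]; nlinarith

lemma external_true {h : ℕ} {q e : Pt} (hp : DD h q) (h1 : 1 ≤ h) (he : EE e) :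
    0 < orient (cc (h + 1) / 2, cc (h + 1) / 2) (TT true q) e := by
  obtain ⟨p1, p2, p3⟩ := hp
  have hc := cc_lt h
  have hc1 := cc_lt (h + 1)
  have hc2 := cc_ge' (h + 1) (by omega)
  generalize cc (h + 1) = m at *
  apply orient_EE he
  · simp [TT]; linarith
  · simp [TT]; linarith
  · simp [TT, orient]; nlinarith
  · simp [TT, orient]; nlinarith

/-- The sign attached to a subtree. -/
def sg (b : Bool) : ℝ := if b then -1 else 1

lemma cross (b : Bool) (u y : List Bool) (h : ℕ) (hu : u.length + 1 < h) (hy : y.length < h)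
    (hne : ∀ t, y ≠ b :: t) (e : Pt) (he : EE e) :
    0 < sg b * orient (PP h (b :: u)) (PP h y) e := by
  obtain ⟨n, rfl⟩ : ∃ n, h = n + 1 := ⟨h - 1, by omega⟩
  have du := PP_DD u n (by omega)
  cases y with
  | nil =>
    cases b
    · have := external_false du (by omega) he
      simpa [sg, PP] using this
    · have := external_true du (by omega) he
      rw [orient_swap] at this
      simpa [sg, PP] using this
  | cons b' t =>
    have dt := PP_DD t n (by simp at hy; omega)
    cases b <;> cases b'
    · exact absurd rfl (hne t)
    · have := internal_EE du dt he
      simpa [sg, PP] using this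
    · have := internal_EE dt du he
      rw [orient_swap] at this
      simpa [sg, PP] using this
    · exact absurd rfl (hne t)

/-- All far away points see the pair `p, q` with the same orientation. -/
def SepP (p q : Pt) : Prop :=
  (∀ e, EE e → 0 < orient p q e) ∨ (∀ e, EE e → orient p q e < 0)

lemma SepP.symm {p q : Pt} (h : SepP p q) : SepP q p := by
  rcases h with h | h
  · right; intro e he; rw [orient_swap]; linarith [h e he]
  · left; intro e he; rw [orient_swap]; linarith [h e he]

lemma SepP.TT {p q : Pt} (b : Bool) (h : SepP p q) : SepP (TT b p) (TT b q) := by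
  rcases h with h | h
  · left; intro e he; rw [orient_UU]; linarith [h _ (EE_UU b e he)]
  · right; intro e he; rw [orient_UU]; linarith [h _ (EE_UU b e he)]

lemma Sep_cross (b : Bool) (u y : List Bool) (h : ℕ) (hu : u.length + 1 < h) (hy : y.length < h)
    (hne : ∀ t, y ≠ b :: t) : SepP (PP h (b :: u)) (PP h y) := by
  cases b
  · left; intro e he
    simpa [sg] using cross false u y h hu hy hne e he
  · right; intro e he
    simpa [sg] using cross true u y h hu hy hne e he

lemma Sep_PP : ∀ (u v : List Bool) (h : ℕ), u.length < h → v.length < h → u ≠ v →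
    SepP (PP h u) (PP h v)
  | [], [], _, _, _, hne => absurd rfl hne
  | [], b :: v, h, hu, hv, _ => (Sep_cross b v [] h (by simpa using hv) hu (by simp)).symm
  | b :: u, [], h, hu, hv, _ => Sep_cross b u [] h (by simpa using hu) hv (by simp)
  | b :: u, b' :: v, h, hu, hv, hne => by
      by_cases hb : b = b'
      · subst hb
        have := Sep_PP u v (h - 1) (by simp at hu; omega) (by simp at hv; omega)
          (by simpa using hne)
        exact this.TT b
      · exact Sep_cross b u (b' :: v) h (by simpa using hu) hv (by
          intro t ht; simp at ht; exact hb ht.1.symm)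

lemma EE_one : EE ((1 : ℝ), (1 : ℝ)) := by
  refine ⟨?_, ?_, ?_⟩ <;> norm_num

lemma PP_inj (u v : List Bool) (h : ℕ) (hu : u.length < h) (hv : v.length < h)
    (he : PP h u = PP h v) : u = v := by
  by_contra hne
  have h0 : orient (PP h v) (PP h v) (1, 1) = 0 := by unfold orient; ring
  rcases Sep_PP u v h hu hv hne with h1 | h1
  · have := h1 _ EE_one
    rw [he, h0] at this; exact lt_irrefl _ this
  · have := h1 _ EE_one
    rw [he, h0] at this; exact lt_irrefl _ this

lemma orient_two (b : Bool) (u v w : List Bool) (h : ℕ) (hu : u.length + 1 < h)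
    (hv : v.length + 1 < h) (hw : w.length < h) (huv : u ≠ v) (hne : ∀ t, w ≠ b :: t) :
    orient (PP h (b :: u)) (PP h (b :: v)) (PP h w) ≠ 0 := by
  simp only [PP]
  rw [orient_UU]
  have he := EE_slot b w h hw hne
  rcases Sep_PP u v (h - 1) (by omega) (by omega) huv with h1 | h1
  · have := h1 _ he
    positivity
  · have := h1 _ he
    intro h0; linarith

lemma orient_center (u v : List Bool) (h : ℕ) (hu : u.length + 1 < h)
    (hv : v.length + 1 < h) :
    0 < orient (PP h (false :: u)) (PP h (true :: v)) (PP h []) := by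
  obtain ⟨n, rfl⟩ : ∃ n, h = n + 1 := ⟨h - 1, by omega⟩
  simpa [PP] using internal_center (PP_DD u n (by omega)) (PP_DD v n (by omega))

lemma orient_center' (b : Bool) (u v : List Bool) (h : ℕ) (hu : u.length + 1 < h)
    (hv : v.length + 1 < h) :
    0 < sg b * orient (PP h (b :: u)) (PP h ((!b) :: v)) (PP h []) := by
  cases b
  · simpa [sg] using orient_center u v h hu hv
  · have := orient_center v u h hv hu
    rw [orient_swap] at this
    simpa [sg] using this

lemma PP_gen : ∀ (a b c : List Bool) (h : ℕ), a.length < h → b.length < h → c.length < h →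
    a ≠ b → a ≠ c → b ≠ c → orient (PP h a) (PP h b) (PP h c) ≠ 0 := by
  intro a
  induction a with
  | nil =>
    intro b c h ha hb hc hab hac hbc
    obtain ⟨x, b, rfl⟩ : ∃ x b', b = x :: b' := by
      cases b with
      | nil => exact absurd rfl hab
      | cons x b' => exact ⟨_, _, rfl⟩
    obtain ⟨y, c, rfl⟩ : ∃ x b', c = x :: b' := by
      cases c with
      | nil => exact absurd rfl hac
      | cons x b' => exact ⟨_, _, rfl⟩
    rw [orient_cyc]
    simp only [List.length_cons] at hb hc
    by_cases hxy : x = y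
    · subst hxy
      exact orient_two x b c [] h hb hc ha (by simpa using hbc) (by simp)
    · have hy : y = !x := by cases x <;> cases y <;> simp_all
      subst hy
      have := orient_center' x b c h hb hc
      intro h0; rw [h0] at this; simp at this
  | cons x a ih =>
    intro b c h ha hb hc hab hac hbc
    simp only [List.length_cons] at ha
    by_cases hbx : ∃ t, b = x :: t
    · obtain ⟨b, rfl⟩ := hbx
      simp only [List.length_cons] at hb
      by_cases hcx : ∃ t, c = x :: t
      · obtain ⟨c, rfl⟩ := hcx
        simp only [List.length_cons] at hc
        simp only [PP]
        rw [orient_TT]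
        have := ih b c (h - 1) (by omega) (by omega) (by omega) (by simpa using hab)
          (by simpa using hac) (by simpa using hbc)
        intro h0; apply this; linarith
      · push Not at hcx
        exact orient_two x a b c h ha hb hc (by simpa using hab) hcx
    · push Not at hbx
      by_cases hcx : ∃ t, c = x :: t
      · obtain ⟨c, rfl⟩ := hcx
        simp only [List.length_cons] at hc
        rw [orient_cyc, orient_cyc]
        exact orient_two x c a b h hc ha hb (by simpa using hac.symm) hbx
      · push Not at hcx
        cases b with
        | nil =>
          cases c with
          | nil => exact absurd rfl hbc
          | cons y c =>
            simp only [List.length_cons] at hc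
            have hy : y = !x := by
              have := hcx c
              cases x <;> cases y <;> simp_all
            subst hy
            have := orient_center' x a c h ha hc
            intro h0
            rw [orient_cyc, orient_cyc, orient_swap] at h0
            have h1 : orient (PP h (x :: a)) (PP h ((!x) :: c)) (PP h []) = 0 := by linarith
            rw [h1] at this; simp at this
        | cons z b =>
          simp only [List.length_cons] at hb
          have hz : z = !x := by
            have := hbx b
            cases x <;> cases z <;> simp_all
          subst hz
          cases c with
          | nil =>
            have := orient_center' x a b h ha hb
            intro h0
            rw [h0] at this; simp at this
          | cons y c =>
            simp only [List.length_cons] at hc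
            have hy : y = !x := by
              have := hcx c
              cases x <;> cases y <;> simp_all
            subst hy
            rw [orient_cyc]
            exact orient_two (!x) b c (x :: a) h hb hc ha (by simpa using hbc) (by
              intro t ht; simp at ht)

/-! ### Triangles -/

def InTri (a b c p : Pt) : Prop :=
  (0 < orient a b p ∧ 0 < orient b c p ∧ 0 < orient c a p) ∨
  (orient a b p < 0 ∧ orient b c p < 0 ∧ orient c a p < 0)

lemma InTri.rot {a b c p : Pt} (h : InTri a b c p) : InTri b c a p := by
  unfold InTri at *; tauto

lemma InTri.swap {a b c p : Pt} (h : InTri a b c p) : InTri b a c p := by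
  unfold InTri at *
  rw [orient_swap b a, orient_swap a c, orient_swap c b]
  rcases h with ⟨h1, h2, h3⟩ | ⟨h1, h2, h3⟩
  · right; refine ⟨?_, ?_, ?_⟩ <;> linarith
  · left; refine ⟨?_, ?_, ?_⟩ <;> linarith

lemma InTri_swap_iff {a b c p : Pt} : InTri b a c p ↔ InTri a b c p :=
  ⟨InTri.swap, InTri.swap⟩

lemma InTri_rot_iff {a b c p : Pt} : InTri b c a p ↔ InTri a b c p :=
  ⟨fun h => h.rot.rot, InTri.rot⟩

lemma InTri_TT (x : Bool) {a b c p : Pt} :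
    InTri (TT x a) (TT x b) (TT x c) (TT x p) ↔ InTri a b c p := by
  have h1 : ∀ r : ℝ, 0 < r / 25 ↔ 0 < r := fun r => by constructor <;> intro h <;> linarith
  have h2 : ∀ r : ℝ, r / 25 < 0 ↔ r < 0 := fun r => by constructor <;> intro h <;> linarith
  unfold InTri
  simp only [orient_TT, h1, h2]

/-- If `w, y` see `u, v` with the same sign then `y` is not in the triangle. -/
lemma InTri_out {u v w y : Pt} (σ : ℝ) (h1 : 0 < σ * orient w y u) (h2 : 0 < σ * orient w y v) :
    ¬ InTri u v w y := by
  intro h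
  have e1 : orient v w y = orient w y v := orient_cyc _ _ _
  have e2 : orient w u y = -orient w y u := by rw [orient_swap, orient_cyc u w y]
  unfold InTri at h
  rw [e1, e2] at h
  rcases lt_trichotomy σ 0 with hs | hs | hs
  · have := neg_of_mul_pos_right h1 hs.le
    have := neg_of_mul_pos_right h2 hs.le
    rcases h with ⟨_, h3, h4⟩ | ⟨_, h3, h4⟩ <;> linarith
  · subst hs; simp at h1
  · have := pos_of_mul_pos_right h1 hs.le
    have := pos_of_mul_pos_right h2 hs.le
    rcases h with ⟨_, h3, h4⟩ | ⟨_, h3, h4⟩ <;> linarith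

lemma InTri_out_Sep {u v w y : Pt} (h : SepP w y) (hu : EE u) (hv : EE v) : ¬ InTri u v w y := by
  rcases h with h | h
  · exact InTri_out 1 (by simpa using h u hu) (by simpa using h v hv)
  · exact InTri_out (-1) (by simpa using h u hu) (by simpa using h v hv)

lemma InTri_out_DD {h : ℕ} {u v w y : Pt} (hu : DD h u) (hv : DD h v) (hw : DD h w) (hy : EE y) :
    ¬ InTri u v w y := by
  have hc := cc_lt h
  have key : orient v w y * (u.1 + u.2 - y.1 - y.2) + orient w u y * (v.1 + v.2 - y.1 - y.2)
      + orient u v y * (w.1 + w.2 - y.1 - y.2) = 0 := by unfold orient; ring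
  have gu : u.1 + u.2 - y.1 - y.2 < 0 := by linarith [hu.2.2, hy.2.2]
  have gv : v.1 + v.2 - y.1 - y.2 < 0 := by linarith [hv.2.2, hy.2.2]
  have gw : w.1 + w.2 - y.1 - y.2 < 0 := by linarith [hw.2.2, hy.2.2]
  rintro (⟨h1, h2, h3⟩ | ⟨h1, h2, h3⟩)
  · linarith [mul_neg_of_pos_of_neg h2 gu, mul_neg_of_pos_of_neg h3 gv,
      mul_neg_of_pos_of_neg h1 gw]
  · linarith [mul_pos_of_neg_of_neg h2 gu, mul_pos_of_neg_of_neg h3 gv,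
      mul_pos_of_neg_of_neg h1 gw]

lemma InTri_center (u v : List Bool) (h : ℕ) (hu : u.length + 1 < h)
    (hv : v.length + 1 < h) (e : Pt) (he : EE e) :
    InTri (PP h (false :: u)) (PP h (true :: v)) e (PP h []) := by
  left
  refine ⟨orient_center u v h hu hv, ?_, ?_⟩
  · have := cross true v [] h hv (by simp; omega) (by simp) e he
    rw [orient_last]
    simpa [sg] using this
  · have := cross false u [] h hu (by simp; omega) (by simp) e he
    rw [orient_cyc]
    simpa [sg] using this

lemma tri2_diff (u v : List Bool) (h : ℕ) (hl : u.length = v.length) (hh : u.length + 1 < h)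
    (e : Pt) (he : EE e) :
    ∀ s : List Bool, s.length < u.length + 1 →
      (InTri (PP h (false :: u)) (PP h (true :: v)) e (PP h s) ↔ s = []) := by
  intro s hs
  constructor
  · intro hT
    cases s with
    | nil => rfl
    | cons b t =>
      exfalso
      simp only [List.length_cons] at hs
      cases b
      · have hS := Sep_PP u t (h - 1) (by omega) (by omega) (by rintro rfl; omega)
        have hv := EE_slot false (true :: v) h (by simp; omega) (by simp)
        refine InTri_out_Sep hS hv (EE_UU false e he) ?_
        rw [← InTri_TT false, TT_UU, TT_UU]
        exact hT.rot
      · have hS := Sep_PP v t (h - 1) (by omega) (by omega) (by rintro rfl; omega)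
        have hv := EE_slot true (false :: u) h (by simp; omega) (by simp)
        refine InTri_out_Sep hS (EE_UU true e he) hv ?_
        rw [← InTri_TT true, TT_UU, TT_UU]
        exact hT.rot.rot
  · rintro rfl
    exact InTri_center u v h hh (by omega) e he

lemma tri2 : ∀ (u v : List Bool) (h : ℕ), u.length = v.length → u.length < h → u ≠ v →
    ∀ e, EE e → ∃ s : List Bool, s.length < u.length ∧ ∀ s' : List Bool, s'.length < u.length →
      (InTri (PP h u) (PP h v) e (PP h s') ↔ s' = s) := by
  intro u
  induction u with
  | nil =>
    intro v h hl _ hne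
    exact absurd (List.eq_nil_of_length_eq_zero hl.symm).symm hne
  | cons b u ih =>
    intro v h hl hh hne e he
    cases v with
    | nil => simp at hl
    | cons c v =>
      simp only [List.length_cons] at hl hh
      have hl' : u.length = v.length := by omega
      by_cases hbc : b = c
      · subst hbc
        obtain ⟨s, hs, hs'⟩ := ih v (h - 1) hl' (by omega) (by simpa using hne) (UU b e)
          (EE_UU b e he)
        refine ⟨b :: s, by simpa using hs, ?_⟩
        intro s' hs1
        simp only [List.length_cons] at hs1
        by_cases hsb : ∃ t, s' = b :: t
        · obtain ⟨t, rfl⟩ := hsb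
          have := hs' t (by simpa using hs1)
          rw [← InTri_TT b, TT_UU] at this
          simpa [PP] using this
        · push Not at hsb
          constructor
          · intro hT
            exfalso
            have c1 := cross b u s' h hh (by omega) hsb e he
            have c2 := cross b v s' h (by omega) (by omega) hsb e he
            refine InTri_out (-sg b) ?_ ?_ hT
            · rw [orient_flip]; linarith
            · rw [orient_flip]; linarith
          · intro hT
            exact absurd hT (hsb s)
      · cases b <;> cases c
        · exact absurd rfl hbc
        · exact ⟨[], by simp, tri2_diff u v h hl' hh e he⟩
        · refine ⟨[], by simp, fun s' hs' => ?_⟩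
          rw [InTri_swap_iff]
          exact tri2_diff v u h hl'.symm (by omega) e he s' (by simpa [hl'] using hs')
        · exact absurd rfl hbc

lemma tri3_two (b : Bool) (u v w : List Bool) (h : ℕ) (huv : u.length = v.length)
    (huw : u.length = w.length) (hh : u.length + 1 < h) (hne : u ≠ v) :
    ∃ s : List Bool, s ≠ [] ∧ s.length < u.length + 1 ∧
      ∀ s' : List Bool, s'.length < u.length + 1 →
      (InTri (PP h (b :: u)) (PP h (b :: v)) (PP h ((!b) :: w)) (PP h s') ↔ s' = s) := by
  obtain ⟨s, hs, hs'⟩ := tri2 u v (h - 1) huv (by omega) hne (UU b (PP h ((!b) :: w)))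
    (EE_slot b _ h (by simp; omega) (by intro t ht; simp at ht))
  refine ⟨b :: s, by simp, by simpa using hs, ?_⟩
  intro s' hs1
  by_cases hsb : ∃ t, s' = b :: t
  · obtain ⟨t, rfl⟩ := hsb
    have := hs' t (by simpa using hs1)
    rw [← InTri_TT b, TT_UU] at this
    simpa [PP] using this
  · push Not at hsb
    constructor
    · intro hT
      exfalso
      cases s' with
      | nil =>
        have c1 := orient_center' b u w h hh (by omega)
        have c2 := orient_center' b v w h (by omega) (by omega)
        rw [orient_cyc] at c1 c2
        exact InTri_out (sg b) c1 c2 hT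
      | cons x t =>
        have hx : x = !b := by
          have := hsb t
          cases x <;> cases b <;> simp_all
        subst hx
        simp only [List.length_cons] at hs1
        have hS := Sep_PP w t (h - 1) (by omega) (by omega) (by rintro rfl; omega)
        refine InTri_out_Sep hS
          (EE_slot (!b) (b :: u) h (by simp; omega) (by intro t ht; simp at ht))
          (EE_slot (!b) (b :: v) h (by simp; omega) (by intro t ht; simp at ht)) ?_
        rw [← InTri_TT (!b), TT_UU, TT_UU]
        exact hT
    · intro hT
      exact absurd hT (hsb s)

lemma tri3 : ∀ (u v w : List Bool) (h : ℕ), u.length = v.length → u.length = w.length →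
    u.length < h → u ≠ v → u ≠ w → v ≠ w →
    ∃ s : List Bool, s ≠ [] ∧ s.length < u.length ∧ ∀ s' : List Bool, s'.length < u.length →
      (InTri (PP h u) (PP h v) (PP h w) (PP h s') ↔ s' = s) := by
  intro u
  induction u with
  | nil =>
    intro v w h hl _ _ hne
    exact absurd (List.eq_nil_of_length_eq_zero hl.symm).symm hne
  | cons b u ih =>
    intro v w h hv hw hh huv huw hvw
    cases v with
    | nil => simp at hv
    | cons c v =>
    cases w with
    | nil => simp at hw
    | cons d w =>
      simp only [List.length_cons] at hv hw hh ⊢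
      have hv' : u.length = v.length := by omega
      have hw' : u.length = w.length := by omega
      by_cases hbc : c = b
      · subst hbc
        by_cases hbd : d = c
        · subst hbd
          obtain ⟨s, _, hs, hs'⟩ := ih v w (h - 1) hv' hw' (by omega) (by simpa using huv)
            (by simpa using huw) (by simpa using hvw)
          refine ⟨d :: s, by simp, by simpa using hs, ?_⟩
          intro s' hs1
          by_cases hsb : ∃ t, s' = d :: t
          · obtain ⟨t, rfl⟩ := hsb
            have := hs' t (by simpa using hs1)
            rw [← InTri_TT d] at this
            simpa [PP] using this
          · push Not at hsb
            constructor
            · intro hT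
              exfalso
              refine InTri_out_DD (PP_DD u (h - 1) (by omega)) (PP_DD v (h - 1) (by omega))
                (PP_DD w (h - 1) (by omega)) (EE_slot d s' h (by omega) hsb) ?_
              rw [← InTri_TT d, TT_UU]
              exact hT
            · intro hT
              exact absurd hT (hsb s)
        · have hd : d = !c := by cases c <;> cases d <;> simp_all
          subst hd
          exact tri3_two c u v w h hv' hw' hh (by simpa using huv)
      · have hc : c = !b := by cases c <;> cases b <;> simp_all
        subst hc
        by_cases hbd : d = b
        · subst hbd
          obtain ⟨s, h1, h2, h3⟩ := tri3_two d w u v h (by omega) (by omega) (by omega)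
            (by simpa using huw.symm)
          refine ⟨s, h1, by omega, fun s' hs' => ?_⟩
          rw [InTri_rot_iff]
          exact h3 s' (by omega)
        · have hd : d = !b := by cases b <;> cases d <;> simp_all
          subst hd
          obtain ⟨s, h1, h2, h3⟩ := tri3_two (!b) v w u h (by omega) (by omega) (by omega)
            (by simpa using hvw)
          rw [Bool.not_not] at h3
          refine ⟨s, h1, by omega, fun s' hs' => ?_⟩
          rw [← InTri_rot_iff]
          exact h3 s' (by omega)

/-- Every internal node lies in a triangle of leaves. -/
lemma inner_leaves : ∀ (s : List Bool) (j h : ℕ), s.length < j → j < h →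
    ∃ u v : List Bool, u.length = j ∧ v.length = j ∧
      ∀ e, EE e → InTri (PP h u) (PP h v) e (PP h s)
  | [], j, h, hs, hj => by
      simp only [List.length_nil] at hs
      refine ⟨false :: List.replicate (j - 1) false, true :: List.replicate (j - 1) false,
        by simp; omega, by simp; omega, fun e he => ?_⟩
      exact InTri_center _ _ h (by simp; omega) (by simp; omega) e he
  | b :: s, j, h, hs, hj => by
      simp only [List.length_cons] at hs
      obtain ⟨u, v, hu, hv, huv⟩ := inner_leaves s (j - 1) (h - 1) (by omega) (by omega)
      refine ⟨b :: u, b :: v, by simp; omega, by simp; omega, fun e he => ?_⟩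
      have := huv _ (EE_UU b e he)
      rw [← InTri_TT b, TT_UU] at this
      exact this

lemma inner_leaves' (s : List Bool) (j h : ℕ) (h0 : s ≠ []) (hs : s.length < j) (hj : j < h) :
    ∃ u v w : List Bool, u.length = j ∧ v.length = j ∧ w.length = j ∧
      InTri (PP h u) (PP h v) (PP h w) (PP h s) := by
  cases s with
  | nil => exact absurd rfl h0
  | cons b s =>
    simp only [List.length_cons] at hs
    obtain ⟨u, v, hu, hv, huv⟩ := inner_leaves s (j - 1) (h - 1) (by omega) (by omega)
    refine ⟨b :: u, b :: v, (!b) :: List.replicate (j - 1) false, by simp; omega, by simp; omega,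
      by simp; omega, ?_⟩
    have := huv _ (EE_slot b ((!b) :: List.replicate (j - 1) false) h (by simp; omega)
      (by intro t ht; simp at ht))
    rw [← InTri_TT b, TT_UU] at this
    exact this

/-- Every leaf is strictly separated from all other nodes. -/
lemma leaf_sep : ∀ (u : List Bool) (h : ℕ), u.length < h →
    ∃ α β : ℝ, (∀ e, EE e → α * (PP h u).1 + β * (PP h u).2 < α * e.1 + β * e.2) ∧
      ∀ y : List Bool, y.length ≤ u.length → y ≠ u →
        α * (PP h u).1 + β * (PP h u).2 < α * (PP h y).1 + β * (PP h y).2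
  | [], h, hh => by
      refine ⟨1, 1, ?_, ?_⟩
      · intro e he
        have := (PP_DD [] h hh).2.2
        have := cc_lt h
        linarith [he.2.2]
      · intro y hy hne
        simp at hy
        exact absurd hy hne
  | b :: u, h, hh => by
      simp only [List.length_cons] at hh
      obtain ⟨α, β, h1, h2⟩ := leaf_sep u (h - 1) (by omega)
      obtain ⟨α', β', γ, hf⟩ : ∃ α' β' γ : ℝ, ∀ p : Pt,
          α' * p.1 + β' * p.2 = α * (UU b p).1 + β * (UU b p).2 + γ := by
        cases b
        · refine ⟨5 * α + 5 * β, 5 * β, β, fun p => ?_⟩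
          simp [UU]; ring
        · refine ⟨5 * α, 5 * α + 5 * β, α, fun p => ?_⟩
          simp [UU]; ring
      refine ⟨α', β', ?_, ?_⟩
      · intro e he
        rw [hf, hf]
        simp only [PP, UU_TT]
        linarith [h1 _ (EE_UU b e he)]
      · intro y hy hne
        rw [hf, hf]
        simp only [List.length_cons] at hy
        by_cases hyb : ∃ t, y = b :: t
        · obtain ⟨t, rfl⟩ := hyb
          simp only [PP, UU_TT]
          linarith [h2 t (by simpa using hy) (by simpa using hne)]
        · push Not at hyb
          have := h1 _ (EE_slot b y h (by omega) hyb)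
          simp only [PP, UU_TT] at this ⊢
          linarith

/-! ### Convex geometry -/

lemma extreme_of_sep {S : Set Pt} {l : Pt} (hl : l ∈ S) (α β : ℝ)
    (hf : ∀ y ∈ S, y ≠ l → α * l.1 + β * l.2 < α * y.1 + β * y.2) : l ∈ extremePts S := by
  have hK : convexHull ℝ S ⊆ {p | p = l ∨ α * l.1 + β * l.2 < α * p.1 + β * p.2} := by
    apply convexHull_min
    · intro y hy
      by_cases hyl : y = l
      · left; exact hyl
      · right; exact hf y hy hyl
    · rw [convex_iff_forall_pos]
      intro x hx y hy a b ha hb hab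
      have e : ∀ c : ℝ, c = a * c + b * c := fun c => by rw [← add_mul, hab, one_mul]
      have e1 := e (α * l.1 + β * l.2)
      rcases hx with rfl | hx
      · rcases hy with rfl | hy
        · left
          rw [← add_smul, hab, one_smul]
        · right
          simp only [Prod.fst_add, Prod.snd_add, Prod.smul_fst, Prod.smul_snd, smul_eq_mul]
          have := mul_lt_mul_of_pos_left hy hb
          linarith
      · right
        simp only [Prod.fst_add, Prod.snd_add, Prod.smul_fst, Prod.smul_snd, smul_eq_mul]
        have h1 := mul_lt_mul_of_pos_left hx ha
        rcases hy with rfl | hy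
        · linarith
        · have := mul_lt_mul_of_pos_left hy hb
          linarith
  refine mem_extremePoints.2 ⟨subset_convexHull ℝ S hl, ?_⟩
  intro x hx y hy hxy
  obtain ⟨a, b, ha, hb, hab, h⟩ := hxy
  have h1 : a * x.1 + b * y.1 = l.1 := by rw [← h]; simp
  have h2 : a * x.2 + b * y.2 = l.2 := by rw [← h]; simp
  have e : ∀ c : ℝ, c = a * c + b * c := fun c => by rw [← add_mul, hab, one_mul]
  have e1 := e (α * l.1 + β * l.2)
  have e2 : α * l.1 + β * l.2 = a * (α * x.1 + β * x.2) + b * (α * y.1 + β * y.2) := by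
    rw [← h1, ← h2]; ring
  rcases hK hx with rfl | hx
  · rcases hK hy with rfl | hy
    · exact ⟨rfl, rfl⟩
    · have := mul_lt_mul_of_pos_left hy hb
      linarith
  · have h1 := mul_lt_mul_of_pos_left hx ha
    rcases hK hy with rfl | hy
    · linarith
    · have := mul_lt_mul_of_pos_left hy hb
      linarith

lemma orient_sum (a b c p : Pt) :
    orient a b p + orient b c p + orient c a p = orient a b c := by
  unfold orient; ring

lemma mem_hull_of_pos {a b c p : Pt} (h1 : 0 < orient a b p) (h2 : 0 < orient b c p)
    (h3 : 0 < orient c a p) : p ∈ convexHull ℝ ({a, b, c} : Set Pt) := by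
  have hs := orient_sum a b c p
  have hD : 0 < orient a b c := by linarith
  have hp : p = (orient b c p / orient a b c) • a + (orient c a p / orient a b c) • b
      + (orient a b p / orient a b c) • c := by
    ext
    · simp only [Prod.fst_add, Prod.smul_fst, smul_eq_mul]
      field_simp
      unfold orient; ring
    · simp only [Prod.snd_add, Prod.smul_snd, smul_eq_mul]
      field_simp
      unfold orient; ring
  have key := (convex_convexHull ℝ ({a, b, c} : Set Pt)).sum_mem (t := Finset.univ)
    (w := ![orient b c p / orient a b c, orient c a p / orient a b c, orient a b p / orient a b c])
    (z := ![a, b, c]) (by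
      intro i _
      fin_cases i <;> simp <;> positivity) (by
      simp only [Fin.sum_univ_three, Matrix.cons_val]
      field_simp
      linarith) (by
      intro i _
      apply subset_convexHull
      fin_cases i <;> simp)
  simp only [Fin.sum_univ_three, Matrix.cons_val] at key
  rw [hp]
  exact key

lemma pos_of_mem_interior {a b c p : Pt} (hD : 0 < orient a b c)
    (hp : p ∈ interior (convexHull ℝ ({a, b, c} : Set Pt))) : 0 < orient a b p := by
  have hsub : convexHull ℝ ({a, b, c} : Set Pt) ⊆ {q | 0 ≤ orient a b q} := by
    apply convexHull_min
    · rintro q (rfl | rfl | rfl)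
      · simp [orient]
      · simp [orient, mul_comm]
      · exact hD.le
    · intro x hx y hy s t hs ht hst
      have hx : 0 ≤ orient a b x := hx
      have hy : 0 ≤ orient a b y := hy
      have : orient a b (s • x + t • y) = s * orient a b x + t * orient a b y := by
        obtain rfl : t = 1 - s := by linarith
        simp [orient]; ring
      show 0 ≤ orient a b (s • x + t • y)
      rw [this]; positivity
  have hcont : Filter.Tendsto (fun t : ℝ => p + t • (p - c)) (nhdsWithin 0 (Set.Ioi 0)) (nhds p) := by
    have : Continuous (fun t : ℝ => p + t • (p - c)) := by fun_prop
    have h0 := this.tendsto 0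
    simp only [zero_smul, add_zero] at h0
    exact h0.mono_left nhdsWithin_le_nhds
  have hev := hcont.eventually (isOpen_interior.mem_nhds hp)
  obtain ⟨t, ht, ht0⟩ := (hev.and self_mem_nhdsWithin).exists
  have ht0 : 0 < t := ht0
  have h1 : 0 ≤ orient a b (p + t • (p - c)) := hsub (interior_subset ht)
  have h2 : orient a b (p + t • (p - c)) = (1 + t) * orient a b p - t * orient a b c := by
    simp [orient]; ring
  rw [h2] at h1
  have h3 : 0 < t * orient a b c := by positivity
  by_contra hneg
  push Not at hneg
  nlinarith

lemma interior_pos {a b c p : Pt} (hD : 0 < orient a b c)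
    (hp : p ∈ interior (convexHull ℝ ({a, b, c} : Set Pt))) :
    0 < orient a b p ∧ 0 < orient b c p ∧ 0 < orient c a p := by
  have e1 : ({a, b, c} : Set Pt) = {b, c, a} := by ext; simp; tauto
  have e2 : ({a, b, c} : Set Pt) = {c, a, b} := by ext; simp; tauto
  refine ⟨pos_of_mem_interior hD hp, pos_of_mem_interior (c := a) ?_ (by rwa [← e1]),
    pos_of_mem_interior (c := b) ?_ (by rwa [← e2])⟩
  · rwa [← orient_cyc]
  · rwa [orient_cyc]

lemma mem_interior_of_pos {a b c p : Pt} (h1 : 0 < orient a b p) (h2 : 0 < orient b c p)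
    (h3 : 0 < orient c a p) : p ∈ interior (convexHull ℝ ({a, b, c} : Set Pt)) := by
  have hc : ∀ u v : Pt, IsOpen {q | 0 < orient u v q} := fun u v =>
    isOpen_lt continuous_const (by unfold orient; fun_prop)
  refine interior_maximal (t := {q | 0 < orient a b q} ∩ ({q | 0 < orient b c q} ∩
    {q | 0 < orient c a q})) ?_ ((hc _ _).inter ((hc _ _).inter (hc _ _))) ⟨h1, h2, h3⟩
  rintro q ⟨q1, q2, q3⟩
  exact mem_hull_of_pos q1 q2 q3

lemma interior_iff {a b c p : Pt} (hD : orient a b c ≠ 0) :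
    p ∈ interior (convexHull ℝ ({a, b, c} : Set Pt)) ↔ InTri a b c p := by
  have e1 : ({a, b, c} : Set Pt) = {b, a, c} := by ext; simp; tauto
  constructor
  · intro hp
    rcases lt_or_gt_of_ne hD with h | h
    · apply InTri.swap
      left
      rw [e1] at hp
      exact interior_pos (by rw [orient_swap]; linarith) hp
    · left; exact interior_pos h hp
  · rintro (⟨h1, h2, h3⟩ | ⟨h1, h2, h3⟩)
    · exact mem_interior_of_pos h1 h2 h3
    · rw [e1]
      apply mem_interior_of_pos <;> rw [orient_swap] <;> linarith

/-! ### The final drawing -/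

def LL (k : ℕ) : ℝ := 2 * 5 ^ (k + 1)

lemma LL_pos (k : ℕ) : 0 < LL k := by unfold LL; positivity

def QQ (k : ℕ) (s : List Bool) : Pt := LL k • PP (k + 1) s

def nodes (j : ℕ) : Set (List Bool) := {s | s ≠ [] ∧ s.length ≤ j}

def SS (k j : ℕ) : Set Pt := QQ k '' nodes j

lemma orient_smul (L : ℝ) (a b c : Pt) :
    orient (L • a) (L • b) (L • c) = L ^ 2 * orient a b c := by
  simp [orient]; ring

lemma QQ_inj {k : ℕ} {u v : List Bool} (hu : u.length ≤ k) (hv : v.length ≤ k)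
    (h : QQ k u = QQ k v) : u = v := by
  apply PP_inj u v (k + 1) (by omega) (by omega)
  exact smul_right_injective Pt (LL_pos k).ne' h

lemma QQ_gen {k : ℕ} {a b c : List Bool} (ha : a.length ≤ k) (hb : b.length ≤ k)
    (hc : c.length ≤ k) (hab : a ≠ b) (hac : a ≠ c) (hbc : b ≠ c) :
    orient (QQ k a) (QQ k b) (QQ k c) ≠ 0 := by
  unfold QQ
  rw [orient_smul]
  exact mul_ne_zero (pow_ne_zero _ (LL_pos k).ne')
    (PP_gen a b c (k + 1) (by omega) (by omega) (by omega) hab hac hbc)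

lemma QQ_InTri {k : ℕ} {a b c p : List Bool} :
    InTri (QQ k a) (QQ k b) (QQ k c) (QQ k p) ↔
      InTri (PP (k + 1) a) (PP (k + 1) b) (PP (k + 1) c) (PP (k + 1) p) := by
  have hL : 0 < LL k ^ 2 := pow_pos (LL_pos k) 2
  have h2 : ∀ r : ℝ, LL k ^ 2 * r < 0 ↔ r < 0 := fun r => by
    rw [← neg_pos, ← mul_neg, mul_pos_iff_of_pos_left hL, neg_pos]
  unfold InTri QQ
  simp only [orient_smul, mul_pos_iff_of_pos_left hL, h2]

lemma InTri_ne {a b c p : Pt} (h : InTri a b c p) : p ∉ ({a, b, c} : Set Pt) := by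
  have e1 : ∀ x y : Pt, orient x y x = 0 := fun x y => by unfold orient; ring
  have e2 : ∀ x y : Pt, orient x y y = 0 := fun x y => by unfold orient; ring
  rintro (rfl | rfl | rfl)
  · unfold InTri at h; rw [e1] at h
    rcases h with ⟨h1, _, _⟩ | ⟨h1, _, _⟩ <;> exact lt_irrefl _ h1
  · unfold InTri at h; rw [e2] at h
    rcases h with ⟨h1, _, _⟩ | ⟨h1, _, _⟩ <;> exact lt_irrefl _ h1
  · unfold InTri at h; rw [e2] at h
    rcases h with ⟨_, h1, _⟩ | ⟨_, h1, _⟩ <;> exact lt_irrefl _ h1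

lemma extreme_SS {k j : ℕ} (hj : 1 ≤ j) (hjk : j ≤ k) :
    extremePts (SS k j) = QQ k '' {s | s.length = j} := by
  apply Set.Subset.antisymm
  · intro p hp
    obtain ⟨s, ⟨hs0, hsj⟩, rfl⟩ := extremePoints_convexHull_subset hp
    refine ⟨s, ?_, rfl⟩
    by_contra hne
    have hlt : s.length < j := lt_of_le_of_ne hsj hne
    obtain ⟨u, v, w, hu, hv, hw, hT⟩ := inner_leaves' s j (k + 1) hs0 hlt (by omega)
    rw [← QQ_InTri] at hT
    have hmem : ∀ u : List Bool, u.length = j → QQ k u ∈ SS k j := by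
      intro u hu
      exact ⟨u, ⟨by rintro rfl; simp at hu; omega, hu.le⟩, rfl⟩
    have hsub : convexHull ℝ ({QQ k u, QQ k v, QQ k w} : Set Pt) ⊆ convexHull ℝ (SS k j) := by
      apply convexHull_mono
      rintro x (rfl | rfl | rfl)
      · exact hmem u hu
      · exact hmem v hv
      · exact hmem w hw
    have hD : orient (QQ k u) (QQ k v) (QQ k w) ≠ 0 := by
      have := orient_sum (QQ k u) (QQ k v) (QQ k w) (QQ k s)
      rcases hT with ⟨h1, h2, h3⟩ | ⟨h1, h2, h3⟩ <;> intro h0 <;> linarith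
    have hin := interior_subset ((interior_iff hD).2 hT)
    have hext := inter_extremePoints_subset_extremePoints_of_subset hsub ⟨hin, hp⟩
    exact InTri_ne hT (extremePoints_convexHull_subset hext)
  · rintro _ ⟨u, hu, rfl⟩
    have hu : u.length = j := hu
    obtain ⟨α, β, _, h⟩ := leaf_sep u (k + 1) (by omega)
    have hm : QQ k u ∈ SS k j := ⟨u, ⟨by rintro rfl; simp at hu; omega, hu.le⟩, rfl⟩
    apply extreme_of_sep hm α β
    rintro _ ⟨y, ⟨_, hy⟩, rfl⟩ hne
    have := h y (by omega) (by rintro rfl; exact hne rfl)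
    have := mul_lt_mul_of_pos_left this (LL_pos k)
    simp only [QQ, Prod.smul_fst, Prod.smul_snd, smul_eq_mul]
    linarith

lemma peel_SS {k j : ℕ} (hjk : j + 1 ≤ k) : peel (SS k (j + 1)) = SS k j := by
  unfold peel
  rw [extreme_SS (by omega) hjk]
  ext p
  constructor
  · rintro ⟨⟨s, ⟨h0, hs⟩, rfl⟩, h⟩
    refine ⟨s, ⟨h0, ?_⟩, rfl⟩
    by_contra hlt
    exact h ⟨s, show s.length = j + 1 by omega, rfl⟩
  · rintro ⟨s, ⟨h0, hs⟩, rfl⟩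
    refine ⟨⟨s, ⟨h0, by omega⟩, rfl⟩, ?_⟩
    rintro ⟨t, ht, hts⟩
    have ht : t.length = j + 1 := ht
    have := QQ_inj (by omega) (by omega) hts
    subst this
    omega

lemma peel_iter {k : ℕ} : ∀ i, i ≤ k → peel^[i] (SS k k) = SS k (k - i)
  | 0, _ => rfl
  | i + 1, hi => by
      rw [Function.iterate_succ_apply', peel_iter i (by omega)]
      have : k - i = (k - (i + 1)) + 1 := by omega
      rw [this]
      exact peel_SS (by omega)

lemma SS_zero (k : ℕ) : SS k 0 = ∅ := by
  unfold SS nodes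
  rw [Set.image_eq_empty]
  ext s
  simp

lemma SS_ne (k j : ℕ) (hj : 1 ≤ j) : SS k j ≠ ∅ := by
  apply Set.Nonempty.ne_empty
  exact ⟨QQ k [false], [false], ⟨by simp, by simpa using hj⟩, rfl⟩

lemma layers_eq {k k' : ℕ} (h : HasLayers (SS k k) k') : k' = k := by
  obtain ⟨h1, h2⟩ := h
  rcases lt_trichotomy k' k with hlt | heq | hlt
  · rw [peel_iter k' hlt.le] at h1
    exact absurd h1 (SS_ne k _ (by omega))
  · exact heq
  · refine absurd ?_ (h2 k hlt)
    rw [peel_iter k le_rfl, Nat.sub_self, SS_zero]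

lemma all_card (j : ℕ) : {s : List Bool | s.length ≤ j}.Finite ∧
    {s : List Bool | s.length ≤ j}.ncard = 2 ^ (j + 1) - 1 := by
  induction j with
  | zero =>
    have : {s : List Bool | s.length ≤ 0} = {[]} := by ext; simp
    rw [this]; simp
  | succ j ih =>
    obtain ⟨hf, hc⟩ := ih
    have e : {s : List Bool | s.length ≤ j + 1} =
        insert [] ((List.cons false '' {s : List Bool | s.length ≤ j}) ∪
          (List.cons true '' {s : List Bool | s.length ≤ j})) := by
      ext s
      cases s with
      | nil => simp
      | cons b t => cases b <;> simp
    have hf1 := hf.image (List.cons false)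
    have hf2 := hf.image (List.cons true)
    rw [e]
    refine ⟨(hf1.union hf2).insert _, ?_⟩
    rw [Set.ncard_insert_of_notMem (by simp) (hf1.union hf2), Set.ncard_union_eq _ hf1 hf2,
      Set.ncard_image_of_injective _ (List.cons_injective),
      Set.ncard_image_of_injective _ (List.cons_injective), hc]
    · have : 1 ≤ 2 ^ (j + 1) := Nat.one_le_two_pow
      rw [pow_succ 2 (j + 1)]; omega
    · rw [Set.disjoint_left]
      rintro _ ⟨a, _, rfl⟩ ⟨b, _, hb⟩
      simp at hb

lemma nodes_card (j : ℕ) : (nodes j).Finite ∧ (nodes j).ncard = 2 ^ (j + 1) - 2 := by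
  have e : nodes j = {s : List Bool | s.length ≤ j} \ {[]} := by
    ext s; simp [nodes, and_comm]
  obtain ⟨hf, hc⟩ := all_card j
  rw [e]
  refine ⟨hf.diff, ?_⟩
  rw [Set.ncard_diff_singleton_of_mem (by simp), hc]
  omega

lemma SS_nacs {k : ℕ} (hk : 1 ≤ k) : IsNACS (SS k k) := by
  refine ⟨(nodes_card k).1.image _, Set.nonempty_iff_ne_empty.2 (SS_ne k k hk), ?_, ?_⟩
  · rintro _ ⟨a, ha, rfl⟩ _ ⟨b, hb, rfl⟩ _ ⟨c, hc, rfl⟩ hab hac hbc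
    exact QQ_gen ha.2 hb.2 hc.2 (by rintro rfl; exact hab rfl) (by rintro rfl; exact hac rfl)
      (by rintro rfl; exact hbc rfl)
  · intro k' hk' j hj hjk
    obtain rfl := layers_eq hk'
    have hl : layer (SS k' k') k' j = QQ k' '' {s | s.length = j} := by
      unfold layer layerSub
      rw [peel_iter _ (by omega), Nat.sub_sub_self hjk, extreme_SS hj hjk]
    have hsub : layerSub (SS k' k') k' (j - 1) = SS k' (j - 1) := by
      unfold layerSub
      rw [peel_iter _ (by omega), Nat.sub_sub_self (by omega)]
    rw [hl, hsub]
    rintro _ ⟨a, ha, rfl⟩ _ ⟨b, hb, rfl⟩ _ ⟨c, hc, rfl⟩ hab hac hbc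
    have ha : a.length = j := ha
    have hb : b.length = j := hb
    have hc : c.length = j := hc
    have hab' : a ≠ b := by rintro rfl; exact hab rfl
    have hac' : a ≠ c := by rintro rfl; exact hac rfl
    have hbc' : b ≠ c := by rintro rfl; exact hbc rfl
    have hD := QQ_gen (k := k') (by omega) (by omega) (by omega) hab' hac' hbc'
    obtain ⟨s, h0, hs, hs'⟩ := tri3 a b c (k' + 1) (by omega) (by omega) (by omega) hab' hac' hbc'
    refine ⟨QQ k' s, ⟨⟨s, ⟨h0, by omega⟩, rfl⟩, ?_⟩, ?_⟩
    · rw [interior_iff hD, QQ_InTri]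
      exact (hs' s hs).2 rfl
    · rintro _ ⟨⟨t, ⟨ht0, ht⟩, rfl⟩, hT⟩
      rw [interior_iff hD, QQ_InTri] at hT
      rw [(hs' t (by omega)).1 hT]

lemma cc_int (h : ℕ) : ∃ n : ℤ, 5 ^ h * cc h = n := by
  induction h with
  | zero => exact ⟨0, by simp [cc]⟩
  | succ h ih =>
    obtain ⟨n, hn⟩ := ih
    refine ⟨5 ^ h + n, ?_⟩
    rw [cc_succ, pow_succ]
    push_cast
    rw [← hn]; ring

lemma PP_int : ∀ (s : List Bool) (h : ℕ), s.length ≤ h →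
    ∃ a b : ℤ, 2 * 5 ^ h * (PP h s).1 = a ∧ 2 * 5 ^ h * (PP h s).2 = b
  | [], h, _ => by
      obtain ⟨n, hn⟩ := cc_int h
      refine ⟨n, n, ?_, ?_⟩ <;> simp only [PP] <;> linarith
  | x :: s, h, hh => by
      obtain ⟨n, rfl⟩ : ∃ n, h = n + 1 := ⟨h - 1, by simp at hh; omega⟩
      obtain ⟨a, b, ha, hb⟩ := PP_int s n (by simpa using hh)
      cases x
      · refine ⟨a, 2 * 5 ^ n - a + b, ?_, ?_⟩ <;> push_cast <;> rw [← ha] <;>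
          simp [PP, TT, pow_succ] <;> try rw [← hb]
        all_goals ring
      · refine ⟨2 * 5 ^ n - b + a, b, ?_, ?_⟩ <;> push_cast <;> rw [← hb] <;>
          simp [PP, TT, pow_succ] <;> try rw [← ha]
        all_goals ring

lemma int_bound {L t : ℝ} {a : ℤ} {N : ℤ} (hL : L = N) (hN : 0 < L) (ha : L * t = a)
    (h0 : 0 < t) (h1 : t < 1) : |a| ≤ N := by
  have h2 : (|a| : ℤ) ≤ (N : ℝ) := by
    rw [Int.cast_abs, ← ha, ← hL, abs_of_pos (by positivity)]
    nlinarith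
  exact_mod_cast h2

/-- For every `k ≥ 1` there is a nested almost convex set with
`2^(k+1) − 2` points whose coordinates are integers of absolute value at most `2·5^(k+1)`. -/
theorem nacs_type1_small_drawing (k : ℕ) (hk : 1 ≤ k) :
    ∃ X : Set Pt, IsNACS X ∧ X.ncard = 2 ^ (k + 1) - 2 ∧
      ∀ p ∈ X, ∃ a b : ℤ, p = ((a : ℝ), (b : ℝ)) ∧
        |a| ≤ 2 * 5 ^ (k + 1) ∧ |b| ≤ 2 * 5 ^ (k + 1) := by
  refine ⟨SS k k, SS_nacs hk, ?_, ?_⟩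
  · unfold SS
    rw [Set.ncard_image_of_injOn, (nodes_card k).2]
    intro u hu v hv huv
    exact QQ_inj hu.2 hv.2 huv
  · rintro _ ⟨s, ⟨_, hs⟩, rfl⟩
    obtain ⟨a, b, ha, hb⟩ := PP_int s (k + 1) (by omega)
    obtain ⟨d1, d2, d3⟩ := PP_DD s (k + 1) (by omega)
    have hc := cc_lt (k + 1)
    refine ⟨a, b, ?_, ?_, ?_⟩
    · rw [← ha, ← hb]
      ext <;> simp [QQ, LL]
    · exact int_bound (by push_cast; rfl) (by positivity) ha d1 (by linarith)
    · exact int_bound (by push_cast; rfl) (by positivity) hb d2 (by linarith)
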